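/- Let x_m be a global maximizer of the noise density f (i.e., f(x_m) ≥ f(x) for all x ∈ ℝ). Then for every t ≤ x_m: (a) f(max{x, x_m}) ≥ f(max{x, t}) for every x ∈ ℝ; (b) B_r(x_m) ≥ B_r(t) for every 1 ≤ r ≤ n; and (c) g(x_m; v) ≥ g(t; v) for every prize schedule v ∈ 𝒱. -/

import Mathlib

open MeasureTheory

/-- The CDF associated with a density `f`. -/
noncomputable def Fcdf (f : ℝ → ℝ) (x : ℝ) : ℝ := ∫ u in Set.Iic x, f u

/-- `F_{(j:m)}`, the CDF of the `j`-th smallest of `m` i.i.d. draws (binomial-sum form),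
with the convention `F_{(0:m)} ≡ 1`. -/
noncomputable def Fos (f : ℝ → ℝ) (j m : ℕ) (x : ℝ) : ℝ :=
  if j = 0 then 1
  else ∑ k ∈ Finset.Icc j m, (m.choose k : ℝ) * Fcdf f x ^ k * (1 - Fcdf f x) ^ (m - k)

/-- `f_{(j:m)}`, the density of the `j`-th smallest of `m` i.i.d. draws,
with the convention `f_{(0:m)} ≡ 0`. -/
noncomputable def fos (f : ℝ → ℝ) (j m : ℕ) (x : ℝ) : ℝ :=
  if j = 0 then 0
  else (j : ℝ) * (m.choose j : ℝ) * Fcdf f x ^ (j - 1) * (1 - Fcdf f x) ^ (m - j) * f x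

/-- The marginal-benefit coefficient `B_r(t)`. -/
noncomputable def Bcoef (f : ℝ → ℝ) (n r : ℕ) (t : ℝ) : ℝ :=
  f t * Fos f (n - r) (n - 1) t + ∫ x in Set.Ioi t, f x * fos f (n - r) (n - 1) x

/-- The marginal benefit of effort `g(t; v)` with threshold `t` and prize schedule `v`. -/
noncomputable def gmb (f : ℝ → ℝ) (n : ℕ) (v : ℕ → ℝ) (t : ℝ) : ℝ :=
  ∑ r ∈ Finset.Icc 1 n, Bcoef f n r t * (v r - v (r + 1))

/-- A noise density: nonnegative, bounded, integrating to one, vanishing outside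
`[xl, xu]` and continuous there.  The endpoints may be infinite. -/
def IsNoiseDensity (f : ℝ → ℝ) (xl xu : EReal) : Prop :=
  xl < xu ∧ (∀ x, 0 ≤ f x) ∧ (∃ M, ∀ x, f x ≤ M) ∧ (∫ x, f x = 1) ∧
    (∀ x : ℝ, ((x : EReal) < xl ∨ xu < (x : EReal)) → f x = 0) ∧
    ContinuousOn f {x : ℝ | xl ≤ (x : EReal) ∧ (x : EReal) ≤ xu}

/-- A prize schedule `v = (v 1, …, v n)`: nonincreasing, nonnegative, summing to one,
with the convention `v (n+1) = 0`. -/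
def IsPrizeSchedule (n : ℕ) (v : ℕ → ℝ) : Prop :=
  (∀ r ∈ Finset.Icc 1 n, 0 ≤ v r) ∧ (∀ r, 1 ≤ r → r < n → v (r + 1) ≤ v r) ∧
    (∑ r ∈ Finset.Icc 1 n, v r = 1) ∧ v (n + 1) = 0

/-- `m` is a mode of `f`. -/
def IsMode (f : ℝ → ℝ) (m : ℝ) : Prop :=
  ∃ a b : ℝ, a < m ∧ m < b ∧ MonotoneOn f (Set.Icc a m) ∧ AntitoneOn f (Set.Icc m b) ∧
    f a < f m ∧ f b < f m

/-- `f` is piecewise monotone: away from finitely many points it is monotone. -/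
def PiecewiseMonotone (f : ℝ → ℝ) : Prop :=
  ∃ s : Finset ℝ, ∀ a b : ℝ, a < b → (∀ c ∈ s, c ∉ Set.Ioo a b) →
    MonotoneOn f (Set.Ioo a b) ∨ AntitoneOn f (Set.Ioo a b)

theorem IsNoiseDensity.integrable {f : ℝ → ℝ} {xl xu : EReal} (hf : IsNoiseDensity f xl xu) :
    Integrable f := by
  by_contra h
  have h1 := hf.2.2.2.1
  rw [integral_undef h] at h1
  exact zero_ne_one h1

theorem IsNoiseDensity.continuousAt {f : ℝ → ℝ} {xl xu : EReal} (hf : IsNoiseDensity f xl xu)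
    {x : ℝ} (hl : (x : EReal) ≠ xl) (hu : (x : EReal) ≠ xu) : ContinuousAt f x := by
  obtain ⟨-, -, -, -, h0, hc⟩ := hf
  have hcoe : Continuous fun y : ℝ => (y : EReal) := continuous_coe_real_ereal
  rcases lt_or_gt_of_ne hl with h | h
  · have : f =ᶠ[nhds x] fun _ => 0 := by
      filter_upwards [(isOpen_lt hcoe continuous_const).mem_nhds h] with y hy
      exact h0 y (Or.inl hy)
    exact continuousAt_const.congr this.symm
  rcases lt_or_gt_of_ne hu with h' | h'
  · refine hc.continuousAt ?_
    filter_upwards [(isOpen_lt hcoe continuous_const).mem_nhds h',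
      (isOpen_lt continuous_const hcoe).mem_nhds h] with y hy hy'
    exact ⟨le_of_lt hy', le_of_lt hy⟩
  · have : f =ᶠ[nhds x] fun _ => 0 := by
      filter_upwards [(isOpen_lt continuous_const hcoe).mem_nhds h'] with y hy
      exact h0 y (Or.inr hy)
    exact continuousAt_const.congr this.symm

theorem Fcdf_eq_add_intervalIntegral {f : ℝ → ℝ} (hf : Integrable f) (x : ℝ) :
    Fcdf f x = Fcdf f 0 + ∫ u in (0 : ℝ)..x, f u := by
  have := intervalIntegral.integral_Iic_sub_Iic (a := 0) (b := x) hf.integrableOn hf.integrableOn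
  unfold Fcdf
  linarith

theorem continuous_Fcdf {f : ℝ → ℝ} (hf : Integrable f) : Continuous (Fcdf f) := by
  rw [funext (Fcdf_eq_add_intervalIntegral hf)]
  exact continuous_const.add
    (intervalIntegral.continuous_primitive (fun _ _ => hf.intervalIntegrable) 0)

theorem hasDerivAt_Fcdf {f : ℝ → ℝ} (hf : Integrable f) {x : ℝ} (hx : ContinuousAt f x) :
    HasDerivAt (Fcdf f) (f x) x := by
  rw [funext (Fcdf_eq_add_intervalIntegral hf)]
  exact (intervalIntegral.integral_hasDerivAt_right hf.intervalIntegrable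
    (hf.aestronglyMeasurable.stronglyMeasurableAtFilter) hx).const_add _

theorem Fcdf_nonneg {f : ℝ → ℝ} (h0 : ∀ x, 0 ≤ f x) (x : ℝ) : 0 ≤ Fcdf f x :=
  setIntegral_nonneg measurableSet_Iic fun y _ => h0 y

theorem Fcdf_le_one {f : ℝ → ℝ} {xl xu : EReal} (hf : IsNoiseDensity f xl xu) (x : ℝ) :
    Fcdf f x ≤ 1 := by
  rw [← hf.2.2.2.1]
  exact setIntegral_le_integral hf.integrable (Filter.Eventually.of_forall hf.2.1)

/-- Derivative of a binomial tail probability in the success probability. -/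
theorem hasDerivAt_binomial_tail (m j : ℕ) (hj : j ≤ m + 1) (p : ℝ) :
    HasDerivAt (fun p : ℝ => ∑ k ∈ Finset.Icc j m, (m.choose k : ℝ) * p ^ k * (1 - p) ^ (m - k))
      ((j : ℝ) * (m.choose j : ℝ) * p ^ (j - 1) * (1 - p) ^ (m - j)) p := by
  induction hj using Nat.decreasingInduction with
  | self => simpa using hasDerivAt_const p (0 : ℝ)
  | of_succ j hj ih =>
    have hjm : j ≤ m := by omega
    have hsum : (fun p : ℝ => ∑ k ∈ Finset.Icc j m,
        (m.choose k : ℝ) * p ^ k * (1 - p) ^ (m - k)) = fun p : ℝ =>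
        (m.choose j : ℝ) * p ^ j * (1 - p) ^ (m - j) + ∑ k ∈ Finset.Icc (j + 1) m,
          (m.choose k : ℝ) * p ^ k * (1 - p) ^ (m - k) := by
      funext q
      rw [← Finset.insert_Icc_add_one_left_eq_Icc hjm, Finset.sum_insert (by simp)]
    rw [hsum]
    have hterm := (((hasDerivAt_pow j p).const_mul (m.choose j : ℝ)).mul
      (((hasDerivAt_id p).const_sub 1).pow (m - j))).add ih
    refine hterm.congr_deriv ?_
    have hc : ((m.choose (j + 1) : ℝ)) * (j + 1) = m.choose j * ((m - j : ℕ) : ℝ) := by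
      exact_mod_cast Nat.choose_succ_right_eq m j
    have he : m - (j + 1) = m - j - 1 := by omega
    simp only [Nat.add_sub_cancel, he, id, Pi.pow_apply]
    push_cast
    linear_combination p ^ j * (1 - p) ^ (m - j - 1) * hc

theorem Fos_nonneg {f : ℝ → ℝ} {xl xu : EReal} (hf : IsNoiseDensity f xl xu) (j m : ℕ) (x : ℝ) :
    0 ≤ Fos f j m x := by
  have h0 := Fcdf_nonneg hf.2.1 x
  have h1 : 0 ≤ 1 - Fcdf f x := sub_nonneg.2 (Fcdf_le_one hf x)
  unfold Fos
  split_ifs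
  · exact zero_le_one
  · exact Finset.sum_nonneg fun k _ => by positivity

theorem fos_nonneg {f : ℝ → ℝ} {xl xu : EReal} (hf : IsNoiseDensity f xl xu) (j m : ℕ) (x : ℝ) :
    0 ≤ fos f j m x := by
  have h0 := Fcdf_nonneg hf.2.1 x
  have h1 : 0 ≤ 1 - Fcdf f x := sub_nonneg.2 (Fcdf_le_one hf x)
  have h2 := hf.2.1 x
  unfold fos
  split_ifs
  · exact le_rfl
  · positivity

theorem continuous_Fos {f : ℝ → ℝ} (hf : Integrable f) (j m : ℕ) : Continuous (Fos f j m) := by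
  have := continuous_Fcdf hf
  unfold Fos
  split_ifs <;> fun_prop

theorem integrable_fos {f : ℝ → ℝ} {xl xu : EReal} (hf : IsNoiseDensity f xl xu) (j m : ℕ) :
    Integrable (fos f j m) := by
  have hF := continuous_Fcdf hf.integrable
  unfold fos
  split_ifs
  · simp
  refine hf.integrable.bdd_mul (c := (j : ℝ) * m.choose j)
    (by fun_prop : Continuous fun x =>
      (j : ℝ) * (m.choose j : ℝ) * Fcdf f x ^ (j - 1) * (1 - Fcdf f x) ^ (m - j)).aestronglyMeasurable
    (Filter.Eventually.of_forall fun x => ?_)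
  have h0 := Fcdf_nonneg hf.2.1 x
  have h1 := Fcdf_le_one hf x
  have h2 : 0 ≤ 1 - Fcdf f x := sub_nonneg.2 h1
  rw [Real.norm_of_nonneg (by positivity)]
  have h3 := pow_le_one₀ (n := j - 1) h0 h1
  have h4 := pow_le_one₀ (n := m - j) h2 (by linarith)
  calc (j : ℝ) * (m.choose j : ℝ) * Fcdf f x ^ (j - 1) * (1 - Fcdf f x) ^ (m - j)
      ≤ (j : ℝ) * (m.choose j : ℝ) * 1 * 1 := by gcongr
    _ = (j : ℝ) * m.choose j := by ring

theorem hasDerivAt_Fos {f : ℝ → ℝ} (hf : Integrable f) {j m : ℕ} (hj : j ≤ m) {x : ℝ}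
    (hx : ContinuousAt f x) : HasDerivAt (Fos f j m) (fos f j m x) x := by
  unfold Fos fos
  split_ifs
  · exact hasDerivAt_const x 1
  · exact (hasDerivAt_binomial_tail m j (by omega) (Fcdf f x)).comp x (hasDerivAt_Fcdf hf hx)

theorem setIntegral_fos {f : ℝ → ℝ} {xl xu : EReal} (hf : IsNoiseDensity f xl xu) {j m : ℕ}
    (hj : j ≤ m) {a b : ℝ} (hab : a ≤ b) :
    ∫ x in Set.Ioc a b, fos f j m x = Fos f j m b - Fos f j m a := by
  rw [← intervalIntegral.integral_of_le hab]
  refine integral_eq_of_hasDerivAt_off_countable_of_le _ _ hab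
    (s := {xl.toReal, xu.toReal}) (Set.toFinite _).countable
    (continuous_Fos hf.integrable j m).continuousOn (fun x hx => ?_)
    (integrable_fos hf j m).intervalIntegrable
  refine hasDerivAt_Fos hf.integrable hj (hf.continuousAt ?_ ?_)
  · rintro rfl
    exact hx.2 (by simp)
  · rintro rfl
    exact hx.2 (by simp)

theorem Bcoef_le_of_isMax {f : ℝ → ℝ} {xl xu : EReal} (hf : IsNoiseDensity f xl xu) {n r : ℕ}
    (hr : 1 ≤ r) {xm t : ℝ} (hmax : ∀ x, f x ≤ f xm) (ht : t ≤ xm) :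
    Bcoef f n r t ≤ Bcoef f n r xm := by
  have hj : n - r ≤ n - 1 := by omega
  have hint : Integrable fun x => f x * fos f (n - r) (n - 1) x :=
    (integrable_fos hf _ _).bdd_mul (c := f xm) hf.integrable.aestronglyMeasurable
      (Filter.Eventually.of_forall fun x => by
        rw [Real.norm_of_nonneg (hf.2.1 x)]
        exact hmax x)
  have hsplit : ∫ x in Set.Ioi t, f x * fos f (n - r) (n - 1) x =
      (∫ x in Set.Ioc t xm, f x * fos f (n - r) (n - 1) x) +
        ∫ x in Set.Ioi xm, f x * fos f (n - r) (n - 1) x := by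
    rw [← Set.Ioc_union_Ioi_eq_Ioi ht]
    exact setIntegral_union (Set.Ioc_disjoint_Ioi le_rfl) measurableSet_Ioi
      hint.integrableOn hint.integrableOn
  have hle : ∫ x in Set.Ioc t xm, f x * fos f (n - r) (n - 1) x ≤
      f xm * (Fos f (n - r) (n - 1) xm - Fos f (n - r) (n - 1) t) := by
    rw [← setIntegral_fos hf hj ht, ← integral_const_mul]
    exact setIntegral_mono hint.integrableOn ((integrable_fos hf _ _).const_mul _).integrableOn
      fun x => mul_le_mul_of_nonneg_right (hmax x) (fos_nonneg hf _ _ x)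
  have hmul := mul_le_mul_of_nonneg_right (hmax t) (Fos_nonneg hf (n - r) (n - 1) t)
  unfold Bcoef
  rw [hsplit]
  linarith

theorem IsPrizeSchedule.sub_nonneg {n : ℕ} {v : ℕ → ℝ} (hv : IsPrizeSchedule n v) {r : ℕ}
    (hr : r ∈ Finset.Icc 1 n) : 0 ≤ v r - v (r + 1) := by
  obtain ⟨h1, hn⟩ := Finset.mem_Icc.1 hr
  rcases hn.lt_or_eq with h | rfl
  · exact _root_.sub_nonneg.2 (hv.2.1 r h1 h)
  · rw [hv.2.2.2, sub_zero]
    exact hv.1 r hr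

/-- If `xm` is a global maximizer of the noise density `f`, then for every
`t ≤ xm`: (a) `f (max x xm) ≥ f (max x t)` pointwise; (b) `B_r(xm) ≥ B_r(t)` for all ranks;
(c) `g(xm; v) ≥ g(t; v)` for every prize schedule. -/
theorem stmt1 (n : ℕ) (hn : 2 ≤ n) (f : ℝ → ℝ) (xl xu : EReal)
    (hf : IsNoiseDensity f xl xu) (xm : ℝ) (hmax : ∀ x, f x ≤ f xm) :
    ∀ t : ℝ, t ≤ xm →
      (∀ x : ℝ, f (max x t) ≤ f (max x xm)) ∧
      (∀ r : ℕ, 1 ≤ r → r ≤ n → Bcoef f n r t ≤ Bcoef f n r xm) ∧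
      (∀ v : ℕ → ℝ, IsPrizeSchedule n v → gmb f n v t ≤ gmb f n v xm) := by
  intro t ht
  refine ⟨fun x => ?_, fun r hr _ => Bcoef_le_of_isMax hf hr hmax ht, fun v hv => ?_⟩
  · rcases le_total x xm with h | h
    · rw [max_eq_right h]
      exact hmax _
    · rw [max_eq_left h, max_eq_left (ht.trans h)]
  · exact Finset.sum_le_sum fun r hr => mul_le_mul_of_nonneg_right
      (Bcoef_le_of_isMax hf (Finset.mem_Icc.1 hr).1 hmax ht) (hv.sub_nonneg hr)
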